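/- The operator T has a unique fixed point in S: there exists exactly one J ∈ S with TJ = J (in particular x ≤ J(x) ≤ x + b̄ for all x ≥ 0, J(x) = 0 for x < 0, and J is nondecreasing and continuous on [0,∞)). -/

import Mathlib

open MeasureTheory Set Filter Topology

noncomputable section

/-- The constant `b̄ = β ∫ z⁺ ν(dz) / (1-β)`. -/
def bbar (ν : Measure ℝ) (β : ℝ) : ℝ := β * (∫ z, max z 0 ∂ν) / (1 - β)

/-- The dynamic programming operator `T`. -/
def Tdiv (ν : Measure ℝ) (β γ : ℝ) (v : ℝ → ℝ) (x : ℝ) : ℝ :=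
  if 0 ≤ x then
    sSup ((fun a => a - (β / γ) * Real.log
      ((∫ z in Ici (a - x), Real.exp (-(γ * v (x - a + z))) ∂ν)
        + (ν (Iio (a - x))).toReal)) '' Icc 0 x)
  else 0

/-- Membership in the set `S₀`. -/
def memS0 (ν : Measure ℝ) (β : ℝ) (v : ℝ → ℝ) : Prop :=
  (∀ x, 0 ≤ v x) ∧ (∀ x, 0 ≤ x → v x ≤ x + bbar ν β) ∧ (∀ x, x < 0 → v x = 0)
    ∧ MonotoneOn v (Ici 0) ∧ ContinuousOn v (Ici 0)

/-- Membership in the set `S`. -/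
def memS (ν : Measure ℝ) (β : ℝ) (v : ℝ → ℝ) : Prop :=
  (∀ x, 0 ≤ v x) ∧ (∀ x, 0 ≤ x → x ≤ v x ∧ v x ≤ x + bbar ν β) ∧ (∀ x, x < 0 → v x = 0)
    ∧ MonotoneOn v (Ici 0) ∧ ContinuousOn v (Ici 0)

/-- A decision rule. -/
def DecisionRule (α : ℝ → ℝ) : Prop :=
  Measurable α ∧ (∀ x, 0 ≤ x → α x ∈ Icc 0 x) ∧ (∀ x, x < 0 → α x = 0)

/-- The operator `L_α` associated with a decision rule `α`. -/
def Ldiv (ν : Measure ℝ) (β γ : ℝ) (α : ℝ → ℝ) (v : ℝ → ℝ) (x : ℝ) : ℝ :=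
  if 0 ≤ x then
    α x - (β / γ) * Real.log
      ((∫ z in Ici (α x - x), Real.exp (-(γ * v (x - α x + z))) ∂ν)
        + (ν (Iio (α x - x))).toReal)
  else 0

/-- The function `Γ` associated with a value function `J`. -/
def Gam (ν : Measure ℝ) (β γ : ℝ) (J : ℝ → ℝ) (x : ℝ) : ℝ :=
  -(β / γ) * Real.log
    ((∫ z in Ici (-x), Real.exp (-(γ * J (x + z))) ∂ν) + (ν (Iio (-x))).toReal)

end
section DividendOperator

variable {ν : Measure ℝ} {β γ d x y : ℝ} {v w : ℝ → ℝ}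

lemma Tdiv_eq_sSup (hx : 0 ≤ x) :
    Tdiv ν β γ v x = sSup ((fun y => x - y + Gam ν β γ v y) '' Icc 0 x) := by
  have hIcc : Icc 0 x = (fun a => x - a) '' Icc 0 x := by simp
  conv_rhs => rw [hIcc, image_image]
  rw [Tdiv, if_pos hx]
  congr 1
  refine image_congr fun a _ => ?_
  rw [Gam, neg_sub]
  ring

lemma Tdiv_le (hx : 0 ≤ x) (h : ∀ y ∈ Icc 0 x, x - y + Gam ν β γ v y ≤ d) :
    Tdiv ν β γ v x ≤ d := by
  rw [Tdiv_eq_sSup hx]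
  refine csSup_le ((nonempty_Icc.mpr hx).image _) ?_
  rintro _ ⟨y, hy, rfl⟩
  exact h y hy

lemma memS.measurable (hv : memS ν β v) : Measurable v := by
  obtain ⟨-, -, hz, -, hc⟩ := hv
  have hcont : Continuous fun x => v (max x 0) :=
    hc.comp_continuous (by fun_prop) fun x => le_max_right x 0
  have heq : v = fun x => if 0 ≤ x then v (max x 0) else 0 := by
    funext x
    split_ifs with h
    · rw [max_eq_left h]
    · exact hz x (not_le.mp h)
  rw [heq]
  exact Measurable.ite measurableSet_Ici hcont.measurable measurable_const

lemma bbar_nonneg (hβ : β ∈ Ioo (0 : ℝ) 1) : 0 ≤ bbar ν β :=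
  div_nonneg (mul_nonneg hβ.1.le (integral_nonneg fun z => le_max_right z 0))
    (sub_nonneg.mpr hβ.2.le)

lemma mul_integral_add_bbar (hβ : β ∈ Ioo (0 : ℝ) 1) :
    β * ((∫ z, max z 0 ∂ν) + bbar ν β) = bbar ν β := by
  have : 1 - β ≠ 0 := (sub_pos.mpr hβ.2).ne'
  rw [bbar]
  field_simp
  ring

lemma memS.dist_le_bbar (hv : memS ν β v) (hw : memS ν β w) (hβ : β ∈ Ioo (0 : ℝ) 1)
    (x : ℝ) : dist (v x) (w x) ≤ bbar ν β := by
  rcases lt_or_ge x 0 with hx | hx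
  · simpa [hv.2.2.1 x hx, hw.2.2.1 x hx] using bbar_nonneg hβ
  · have hv' := hv.2.1 x hx
    have hw' := hw.2.1 x hx
    rw [Real.dist_eq, abs_le]
    constructor <;> linarith

lemma memS_max_zero (hβ : β ∈ Ioo (0 : ℝ) 1) : memS ν β fun x => max x 0 := by
  refine ⟨fun x => le_max_right x 0, fun x hx => ?_, fun x hx => max_eq_right hx.le,
    (monotone_id.max monotone_const).monotoneOn _, by fun_prop⟩
  simpa [hx] using bbar_nonneg hβ

lemma memS_of_tendsto {F : ℕ → ℝ → ℝ} (hF : ∀ n, memS ν β (F n))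
    (hlim : TendstoUniformly F v atTop) : memS ν β v := by
  have hpt : ∀ x, Tendsto (fun n => F n x) atTop (𝓝 (v x)) := fun x => hlim.tendsto_at x
  refine ⟨fun x => ge_of_tendsto' (hpt x) fun n => (hF n).1 x,
    fun x hx => ⟨ge_of_tendsto' (hpt x) fun n => ((hF n).2.1 x hx).1,
      le_of_tendsto' (hpt x) fun n => ((hF n).2.1 x hx).2⟩, fun x hx => ?_,
    fun a ha b hb hab => le_of_tendsto_of_tendsto' (hpt a) (hpt b)
      fun n => (hF n).2.2.2.1 ha hb hab,
    hlim.tendstoUniformlyOn.continuousOn (.of_forall fun n => (hF n).2.2.2.2)⟩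
  refine tendsto_nhds_unique (hpt x) ?_
  simp [(hF _).2.2.1 x hx]

variable [IsProbabilityMeasure ν]

lemma memS.integrable_exp (hv : memS ν β v) (hγ : 0 < γ) (y : ℝ) :
    Integrable (fun z => Real.exp (-(γ * v (y + z)))) ν := by
  have hm := hv.measurable
  refine Integrable.of_bound (C := 1) (Measurable.aestronglyMeasurable (by fun_prop))
    (.of_forall fun z => ?_)
  have := mul_nonneg hγ.le (hv.1 (y + z))
  rw [Real.norm_eq_abs, Real.abs_exp, Real.exp_le_one_iff]
  linarith

lemma memS.integral_exp_pos (hv : memS ν β v) (hγ : 0 < γ) (y : ℝ) :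
    0 < ∫ z, Real.exp (-(γ * v (y + z))) ∂ν :=
  MeasureTheory.integral_exp_pos (hv.integrable_exp hγ y)

lemma memS.gam_eq (hv : memS ν β v) (hγ : 0 < γ) (y : ℝ) :
    Gam ν β γ v y = -(β / γ) * Real.log (∫ z, Real.exp (-(γ * v (y + z))) ∂ν) := by
  have hneg : ∫ z in Iio (-y), Real.exp (-(γ * v (y + z))) ∂ν = (ν (Iio (-y))).toReal := by
    rw [setIntegral_congr_fun (g := fun _ => (1 : ℝ)) measurableSet_Iio]
    · simp [Measure.real]
    · intro z hz
      have : y + z < 0 := by linarith [mem_Iio.mp hz]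
      simp [hv.2.2.1 _ this]
  rw [Gam, ← hneg, ← compl_Ici, integral_add_compl measurableSet_Ici (hv.integrable_exp hγ y)]

lemma memS.continuous_gam (hac : ν ≪ volume) (hv : memS ν β v) (hγ : 0 < γ) :
    Continuous (Gam ν β γ v) := by
  have hm := hv.measurable
  have hcont : Continuous fun y => ∫ z, Real.exp (-(γ * v (y + z))) ∂ν := by
    refine continuous_iff_continuousAt.2 fun y => ?_
    refine continuousAt_of_dominated (bound := fun _ => 1)
      (.of_forall fun y => Measurable.aestronglyMeasurable (by fun_prop))
      (.of_forall fun y => .of_forall fun z => ?_) (integrable_const _) ?_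
    · have := mul_nonneg hγ.le (hv.1 (y + z))
      rw [Real.norm_eq_abs, Real.abs_exp, Real.exp_le_one_iff]
      linarith
    · have hne : ∀ᵐ z ∂ν, z ≠ -y := hac.ae_le (Measure.ae_ne volume (-y))
      filter_upwards [hne] with z hz
      have hvz : ContinuousAt v (y + z) := by
        rcases lt_trichotomy (y + z) 0 with h | h | h
        · refine (continuousAt_const (y := (0 : ℝ))).congr ?_
          filter_upwards [Iio_mem_nhds h] with t ht using (hv.2.2.1 t ht).symm
        · exact absurd (by linarith) hz
        · exact hv.2.2.2.2.continuousAt (Ici_mem_nhds h)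
      have : ContinuousAt (fun t => v (t + z)) y :=
        ContinuousAt.comp (f := fun t => t + z) hvz (by fun_prop)
      fun_prop
  have heq : Gam ν β γ v = fun y =>
      -(β / γ) * Real.log (∫ z, Real.exp (-(γ * v (y + z))) ∂ν) :=
    funext (hv.gam_eq hγ)
  rw [heq]
  exact continuous_const.mul (hcont.log fun y => (hv.integral_exp_pos hγ y).ne')

lemma memS.gam_nonneg (hv : memS ν β v) (hβ : 0 < β) (hγ : 0 < γ) (y : ℝ) :
    0 ≤ Gam ν β γ v y := by
  have hle : ∫ z, Real.exp (-(γ * v (y + z))) ∂ν ≤ 1 := by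
    calc _ ≤ ∫ _, (1 : ℝ) ∂ν := by
          refine integral_mono (hv.integrable_exp hγ y) (integrable_const _) fun z => ?_
          have := mul_nonneg hγ.le (hv.1 (y + z))
          simp only [Real.exp_le_one_iff]
          linarith
      _ = 1 := by simp
  rw [hv.gam_eq hγ, neg_mul]
  have := Real.log_nonpos (hv.integral_exp_pos hγ y).le hle
  have := mul_nonneg (div_pos hβ hγ).le (neg_nonneg.mpr this)
  linarith

lemma memS.gam_le (hint : Integrable (fun z => max z 0) ν) (hv : memS ν β v)
    (hβ : β ∈ Ioo (0 : ℝ) 1) (hγ : 0 < γ) (hy : 0 ≤ y) :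
    Gam ν β γ v y ≤ y + bbar ν β := by
  have hb := bbar_nonneg (ν := ν) hβ
  set c := y + bbar ν β + ∫ z, max z 0 ∂ν with hc
  have hlin : ∫ z, Real.exp (-(γ * c)) * (1 + γ * c - γ * (y + bbar ν β + max z 0)) ∂ν
      = Real.exp (-(γ * c)) := by
    have hi : Integrable (fun z => γ * (y + bbar ν β + max z 0)) ν :=
      ((integrable_const _).add hint).const_mul γ
    rw [integral_const_mul, integral_sub (integrable_const _) hi, integral_const_mul,
      integral_add (integrable_const _) hint]
    simp [hc]
  have hle : Real.exp (-(γ * c)) ≤ ∫ z, Real.exp (-(γ * v (y + z))) ∂ν := by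
    rw [← hlin]
    refine integral_mono ?_ (hv.integrable_exp hγ y) fun z => ?_
    · exact ((integrable_const _).sub
        (((integrable_const _).add hint).const_mul γ)).const_mul _
    · have hvle : v (y + z) ≤ y + bbar ν β + max z 0 := by
        rcases lt_or_ge (y + z) 0 with h | h
        · rw [hv.2.2.1 _ h]
          positivity
        · linarith [(hv.2.1 _ h).2, le_max_left z 0]
      have hmul := mul_le_mul_of_nonneg_left hvle hγ.le
      have hsplit : Real.exp (-(γ * v (y + z)))
          = Real.exp (-(γ * c)) * Real.exp (γ * c - γ * v (y + z)) := by
        rw [← Real.exp_add]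
        ring_nf
      simp only [hsplit]
      refine mul_le_mul_of_nonneg_left ?_ (Real.exp_pos _).le
      linarith [Real.add_one_le_exp (γ * c - γ * v (y + z))]
  have hlog : -(γ * c) ≤ Real.log (∫ z, Real.exp (-(γ * v (y + z))) ∂ν) :=
    (Real.le_log_iff_exp_le (hv.integral_exp_pos hγ y)).mpr hle
  have hmul := mul_le_mul_of_nonneg_left hlog (div_pos hβ.1 hγ).le
  have hcancel : β / γ * -(γ * c) = -(β * c) := by
    field_simp
  have hbb := mul_integral_add_bbar (ν := ν) hβ
  have hβy : β * y ≤ y := mul_le_of_le_one_left hy hβ.2.le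
  have hβc : β * c = β * y + bbar ν β := by
    rw [hc]
    linear_combination hbb
  rw [hv.gam_eq hγ]
  linarith

lemma memS.gam_le_gam_add (hv : memS ν β v) (hw : memS ν β w) (hβ : 0 < β) (hγ : 0 < γ)
    (hd : ∀ x, v x ≤ w x + d) (y : ℝ) : Gam ν β γ v y ≤ Gam ν β γ w y + β * d := by
  have hle : Real.exp (-(γ * d)) * ∫ z, Real.exp (-(γ * w (y + z))) ∂ν
      ≤ ∫ z, Real.exp (-(γ * v (y + z))) ∂ν := by
    rw [← integral_const_mul]
    refine integral_mono ((hw.integrable_exp hγ y).const_mul _) (hv.integrable_exp hγ y)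
      fun z => ?_
    simp only [← Real.exp_add]
    have := mul_le_mul_of_nonneg_left (hd (y + z)) hγ.le
    exact Real.exp_le_exp.mpr (by linarith)
  have hwpos := hw.integral_exp_pos hγ y
  have hlog := Real.log_le_log (mul_pos (Real.exp_pos _) hwpos) hle
  rw [Real.log_mul (Real.exp_pos _).ne' hwpos.ne', Real.log_exp] at hlog
  have hmul := mul_le_mul_of_nonneg_left hlog (div_pos hβ hγ).le
  have hcancel : β / γ * -(γ * d) = -(β * d) := by
    field_simp
  rw [hv.gam_eq hγ, hw.gam_eq hγ]
  linarith

lemma memS.le_Tdiv (hint : Integrable (fun z => max z 0) ν) (hv : memS ν β v)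
    (hβ : β ∈ Ioo (0 : ℝ) 1) (hγ : 0 < γ) (hy : y ∈ Icc 0 x) :
    x - y + Gam ν β γ v y ≤ Tdiv ν β γ v x := by
  rw [Tdiv_eq_sSup (hy.1.trans hy.2)]
  refine le_csSup ⟨x + bbar ν β, ?_⟩ (mem_image_of_mem _ hy)
  rintro _ ⟨t, ht, rfl⟩
  have := hv.gam_le hint hβ hγ ht.1
  simp only
  linarith

lemma memS.Tdiv_memS (hac : ν ≪ volume) (hint : Integrable (fun z => max z 0) ν)
    (hv : memS ν β v) (hβ : β ∈ Ioo (0 : ℝ) 1) (hγ : 0 < γ) : memS ν β (Tdiv ν β γ v) := by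
  have hlow : ∀ x, 0 ≤ x → x ≤ Tdiv ν β γ v x := fun x hx => by
    have := hv.le_Tdiv hint hβ hγ (left_mem_Icc.mpr hx)
    linarith [hv.gam_nonneg hβ.1 hγ 0]
  have hzero : ∀ x, x < 0 → Tdiv ν β γ v x = 0 := fun x hx => if_neg (not_le.mpr hx)
  refine ⟨fun x => ?_, fun x hx => ⟨hlow x hx, ?_⟩, hzero, fun a ha b _ hab => ?_, ?_⟩
  · rcases lt_or_ge x 0 with hx | hx
    · exact (hzero x hx).ge
    · exact hx.trans (hlow x hx)
  · refine Tdiv_le hx fun y hy => ?_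
    linarith [hv.gam_le hint hβ hγ hy.1]
  · refine Tdiv_le ha fun y hy => ?_
    linarith [hv.le_Tdiv hint hβ hγ (Icc_subset_Icc_right hab hy)]
  · have hG := hv.continuous_gam hac hγ
    have hcont : Continuous fun x =>
        sSup ((fun t => x - t * x + Gam ν β γ v (t * x)) '' Icc 0 1) :=
      isCompact_Icc.continuous_sSup
        (f := fun x t => x - t * x + Gam ν β γ v (t * x)) (by
          simp only [Function.HasUncurry.uncurry, id]
          fun_prop)
    refine hcont.continuousOn.congr fun x hx => ?_
    have hIcc : Icc 0 x = (fun t => t * x) '' Icc 0 1 := by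
      rw [image_mul_right_Icc zero_le_one hx, zero_mul, one_mul]
    rw [Tdiv_eq_sSup hx, hIcc, image_image]

lemma memS.Tdiv_le_Tdiv_add (hint : Integrable (fun z => max z 0) ν) (hv : memS ν β v)
    (hw : memS ν β w) (hβ : β ∈ Ioo (0 : ℝ) 1) (hγ : 0 < γ) (hd : ∀ x, v x ≤ w x + d)
    (hx : 0 ≤ x) : Tdiv ν β γ v x ≤ Tdiv ν β γ w x + β * d := by
  refine Tdiv_le hx fun y hy => ?_
  linarith [hv.gam_le_gam_add hw hβ.1 hγ hd y, hw.le_Tdiv hint hβ hγ hy]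

lemma memS.dist_Tdiv_le (hint : Integrable (fun z => max z 0) ν) (hv : memS ν β v)
    (hw : memS ν β w) (hβ : β ∈ Ioo (0 : ℝ) 1) (hγ : 0 < γ)
    (hd : ∀ x, dist (v x) (w x) ≤ d) (x : ℝ) :
    dist (Tdiv ν β γ v x) (Tdiv ν β γ w x) ≤ β * d := by
  have hd' : ∀ x, v x ≤ w x + d ∧ w x ≤ v x + d := fun x => by
    have := abs_le.mp (Real.dist_eq (v x) (w x) ▸ hd x)
    constructor <;> linarith
  rcases lt_or_ge x 0 with hx | hx
  · simpa [Tdiv, not_le.mpr hx] using mul_nonneg hβ.1.le (dist_nonneg.trans (hd x))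
  · rw [Real.dist_eq, abs_le]
    have h₁ := hv.Tdiv_le_Tdiv_add hint hw hβ hγ (fun x => (hd' x).1) hx
    have h₂ := hw.Tdiv_le_Tdiv_add hint hv hβ hγ (fun x => (hd' x).2) hx
    constructor <;> linarith

end DividendOperator

/-- `T` has a unique fixed point in `S`. -/
theorem Tdiv_unique_fixed_point (ν : Measure ℝ) [IsProbabilityMeasure ν]
    (hac : ν ≪ volume) (hint : Integrable (fun z => max z 0) ν)
    (hneg : 0 < ν (Iio 0)) (β γ : ℝ) (hβ : β ∈ Ioo (0:ℝ) 1) (hγ : 0 < γ) :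
    ∃! J : ℝ → ℝ, memS ν β J ∧ Tdiv ν β γ J = J := by
  have hβ1 := hβ.2
  have hiter : ∀ v, memS ν β v → ∀ n, memS ν β ((Tdiv ν β γ)^[n] v) := by
    intro v hv n
    induction n with
    | zero => exact hv
    | succ n ih =>
      rw [Function.iterate_succ_apply']
      exact ih.Tdiv_memS hac hint hβ hγ
  have hcontr : ∀ v w, memS ν β v → memS ν β w → ∀ n x,
      dist ((Tdiv ν β γ)^[n] v x) ((Tdiv ν β γ)^[n] w x) ≤ bbar ν β * β ^ n := by
    intro v w hv hw n
    induction n with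
    | zero => simpa using hv.dist_le_bbar hw hβ
    | succ n ih =>
      intro x
      simp only [Function.iterate_succ_apply']
      refine ((hiter v hv n).dist_Tdiv_le hint (hiter w hw n) hβ hγ ih x).trans_eq ?_
      ring
  have hpow : Tendsto (fun n => bbar ν β * β ^ n) atTop (𝓝 0) := by
    simpa using (tendsto_pow_atTop_nhds_zero_of_lt_one hβ.1.le hβ1).const_mul (bbar ν β)
  have hv₀ := memS_max_zero (ν := ν) hβ
  set F : ℕ → ℝ → ℝ := fun n => (Tdiv ν β γ)^[n] fun x => max x 0
  have hgeom : ∀ x n, dist (F n x) (F (n + 1) x) ≤ bbar ν β * β ^ n := fun x n =>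
    hcontr _ _ hv₀ (hv₀.Tdiv_memS hac hint hβ hγ) n x
  choose J hJ using fun x =>
    cauchySeq_tendsto_of_complete (cauchySeq_of_le_geometric β _ hβ1 (hgeom x))
  have herr : ∀ n x, dist (J x) (F n x) ≤ bbar ν β * β ^ n / (1 - β) := fun n x => by
    rw [dist_comm]
    exact dist_le_of_le_geometric_of_tendsto β _ hβ1 (hgeom x) (hJ x) n
  have herr0 : Tendsto (fun n => bbar ν β * β ^ n / (1 - β)) atTop (𝓝 0) := by
    simpa using hpow.div_const (1 - β)
  have hunif : TendstoUniformly F J atTop := by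
    rw [Metric.tendstoUniformly_iff]
    intro ε hε
    filter_upwards [herr0.eventually_lt_const hε] with n hn x using (herr n x).trans_lt hn
  have hJS : memS ν β J := memS_of_tendsto (hiter _ hv₀) hunif
  have hfix : Tdiv ν β γ J = J := by
    funext x
    refine tendsto_nhds_unique ?_ ((tendsto_add_atTop_iff_nat 1).mpr (hJ x))
    rw [tendsto_iff_dist_tendsto_zero]
    refine squeeze_zero (fun n => dist_nonneg) (fun n => ?_)
      (by simpa using herr0.const_mul β)
    have hsucc : F (n + 1) = Tdiv ν β γ (F n) := Function.iterate_succ_apply' _ _ _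
    rw [dist_comm, hsucc]
    exact hJS.dist_Tdiv_le hint (hiter _ hv₀ n) hβ hγ (herr n) x
  refine ⟨J, ⟨hJS, hfix⟩, fun K hK => ?_⟩
  funext x
  refine dist_le_zero.mp (ge_of_tendsto' hpow fun n => ?_)
  simpa [Function.iterate_fixed hK.2, Function.iterate_fixed hfix]
    using hcontr K J hK.1 hJS n x
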